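/- arXiv:0712.2891 — 5 statements merged into one kernel-verified Lean document; each statement's English description precedes it below -/
import Mathlib

section
/- Let A₀ be a transversal real skew-symmetric m×m matrix with entries of absolute value ≤ 1, and let α ⊊ {1,…,m} be a proper subset (|α| ≤ m − 1). Then there exists a transversal real skew-symmetric m×m matrix A₁ with entries of absolute value ≤ 1 such that the principal submatrices of A₀ and A₁ on the indices in α coincide, (A₁)_α = (A₀)_α (so the restrictions of V_{A₀} and V_{A₁} to the face Γ_α are equal, in particular homotopic), but V_{A₁} is NOT homotopic to V_{A₀} on the whole simplex S^{m−1}. In particular, any transversal Volterra operator given on a proper face has at least two non-homotopic transversal extensions to the whole simplex. -/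
open Matrix

/-- A matrix defining a Volterra quadratic stochastic operator:
skew-symmetric with entries of absolute value at most 1. -/
def IsQSOMatrix {n : Type*} [Fintype n] (A : Matrix n n ℝ) : Prop :=
  Aᵀ = -A ∧ ∀ i j, |A i j| ≤ 1

/-- The Volterra quadratic stochastic operator associated to a matrix `A`:
`(V_A x)_k = x_k (1 + ∑ i, a_{k i} x_i)`. -/
noncomputable def volterra {n : Type*} [Fintype n] (A : Matrix n n ℝ) (x : n → ℝ) : n → ℝ :=
  fun k => x k * (1 + ∑ i, A k i * x i)

/-- The set of fixed points of `V_A` in the standard simplex. -/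
def FixSet {n : Type*} [Fintype n] (A : Matrix n n ℝ) : Set (n → ℝ) :=
  {x ∈ stdSimplex ℝ n | volterra A x = x}

/-- A skew-symmetric matrix is transversal if every principal submatrix on an
evenly-sized index set has nonzero determinant. -/
def IsTransversal {n : Type*} [Fintype n] [DecidableEq n] (A : Matrix n n ℝ) : Prop :=
  ∀ s : Finset n, Even s.card →
    (A.submatrix (fun i : s => (i : n)) (fun i : s => (i : n))).det ≠ 0

/-- Two (transversal) Volterra operators are homotopic if they are joined by a
continuous family of transversal Volterra matrices along which the number of
fixed points is constant. -/
def QSOHomotopic {n : Type*} [Fintype n] [DecidableEq n] (A₀ A₁ : Matrix n n ℝ) : Prop :=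
  ∃ A : ℝ → Matrix n n ℝ,
    ContinuousOn A (Set.Icc 0 1) ∧
    A 0 = A₀ ∧ A 1 = A₁ ∧
    (∀ t ∈ Set.Icc (0:ℝ) 1, IsQSOMatrix (A t) ∧ IsTransversal (A t)) ∧
    (∀ t ∈ Set.Icc (0:ℝ) 1, (FixSet (A t)).ncard = (FixSet A₀).ncard) ∧
    (FixSet A₀).ncard = (FixSet A₁).ncard
/-- The principal submatrix of `A` on the index set `α`, corresponding to the
restriction of the Volterra operator `V_A` to the face `Γ_α`. -/
def restrictM {m : ℕ} (A : Matrix (Fin m) (Fin m) ℝ) (α : Finset (Fin m)) :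
    Matrix α α ℝ :=
  A.submatrix (fun i => (i : Fin m)) (fun i => (i : Fin m))

/-- Off-diagonal entries of a transversal skew-symmetric matrix do not vanish. -/
theorem IsTransversal.apply_ne_zero {n : Type*} [Fintype n] [DecidableEq n]
    {A : Matrix n n ℝ} (hA : IsQSOMatrix A) (hT : IsTransversal A) {i j : n} (hij : i ≠ j) :
    A i j ≠ 0 := by
  intro h
  refine hT {i, j} (by rw [Finset.card_pair hij]; exact even_two) ?_
  have hskew : ∀ k l, A l k = -A k l := fun k l => congrFun (congrFun hA.1 k) l
  have hdiag : A i i = 0 := by linarith [hskew i i]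
  refine Matrix.det_eq_zero_of_row_eq_zero ⟨i, by simp⟩ ?_
  rintro ⟨k, hk⟩
  rcases Finset.mem_insert.1 hk with rfl | hk
  · exact hdiag
  · rw [Finset.mem_singleton] at hk
    subst hk
    exact h

/-- Transversality is preserved by congruence with an invertible diagonal matrix. -/
theorem IsTransversal.diagonal_mul_mul_diagonal {n : Type*} [Fintype n] [DecidableEq n]
    {A : Matrix n n ℝ} (hT : IsTransversal A) {d : n → ℝ} (hd : ∀ i, d i ≠ 0) :
    IsTransversal (diagonal d * A * diagonal d) := by
  intro s hs
  have hsub : (diagonal d * A * diagonal d).submatrix (fun i : s => (i : n)) (fun i : s => (i : n))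
      = diagonal (fun i : s => d i) *
        A.submatrix (fun i : s => (i : n)) (fun i : s => (i : n)) *
        diagonal (fun i : s => d i) := by
    ext i j
    simp [Matrix.mul_diagonal, Matrix.diagonal_mul]
  rw [hsub, det_mul, det_mul, det_diagonal]
  have hprod : ∏ i : s, d i ≠ 0 := Finset.prod_ne_zero_iff.2 fun i _ => hd i
  exact mul_ne_zero (mul_ne_zero hprod (hT s hs)) hprod

/-- Along a homotopy the off-diagonal entries keep their signs. -/
theorem QSOHomotopic.mul_apply_pos {n : Type*} [Fintype n] [DecidableEq n]
    {A₀ A₁ : Matrix n n ℝ} (h : QSOHomotopic A₀ A₁) {i j : n} (hij : i ≠ j) :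
    0 < A₀ i j * A₁ i j := by
  obtain ⟨A, hcont, rfl, rfl, hA, -⟩ := h
  have hne : ∀ t ∈ Set.Icc (0 : ℝ) 1, A t i j ≠ 0 := fun t ht =>
    (hA t ht).2.apply_ne_zero (hA t ht).1 hij
  have hentry : ContinuousOn (fun t => A t i j) (Set.Icc 0 1) := by fun_prop
  by_contra! hle
  have h0 := hne 0 (by simp)
  have h1 := hne 1 (by simp)
  have hzero : (0 : ℝ) ∈ (fun t => A t i j) '' Set.Icc 0 1 := by
    rcases mul_nonpos_iff.1 hle with ⟨ha, hb⟩ | ⟨ha, hb⟩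
    · exact intermediate_value_Icc' zero_le_one hentry ⟨hb, ha⟩
    · exact intermediate_value_Icc zero_le_one hentry ⟨ha, hb⟩
  obtain ⟨t, ht, htz⟩ := hzero
  exact hne t ht htz

theorem exists_nonhomotopic_extension {m : ℕ} (hm : 2 ≤ m)
    (A₀ : Matrix (Fin m) (Fin m) ℝ)
    (h₀ : IsQSOMatrix A₀) (t₀ : IsTransversal A₀)
    (α : Finset (Fin m)) (hα : α ≠ Finset.univ) :
    ∃ A₁ : Matrix (Fin m) (Fin m) ℝ,
      IsQSOMatrix A₁ ∧ IsTransversal A₁ ∧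
      restrictM A₁ α = restrictM A₀ α ∧
      ¬ QSOHomotopic A₀ A₁ := by
  obtain ⟨v, hv⟩ : ∃ v, v ∉ α := by
    by_contra! h
    exact hα (Finset.eq_univ_iff_forall.2 h)
  have : Nontrivial (Fin m) := Fin.nontrivial_iff_two_le.2 hm
  obtain ⟨w, hw⟩ := exists_ne v
  -- Negate the row and the column of an index outside `α`.
  let d : Fin m → ℝ := fun i => if i = v then -1 else 1
  have habs : ∀ i, |d i| = 1 := fun i => by
    by_cases hi : i = v <;> simp [d, hi]
  have happly : ∀ i j, (diagonal d * A₀ * diagonal d) i j = d i * A₀ i j * d j := fun i j => by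
    rw [Matrix.mul_diagonal, Matrix.diagonal_mul]
  refine ⟨diagonal d * A₀ * diagonal d, ⟨?_, fun i j => ?_⟩,
    t₀.diagonal_mul_mul_diagonal fun i hi => ?_, ?_, fun h => ?_⟩
  · simp [Matrix.transpose_mul, h₀.1, Matrix.mul_assoc]
  · rw [happly, abs_mul, abs_mul, habs, habs, one_mul, mul_one]
    exact h₀.2 i j
  · simpa [hi] using habs i
  · ext ⟨i, hi⟩ ⟨j, hj⟩
    have hiv : i ≠ v := fun h => hv (h ▸ hi)
    have hjv : j ≠ v := fun h => hv (h ▸ hj)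
    simp [restrictM, d, hiv, hjv]
  · have hpos := h.mul_apply_pos hw.symm
    rw [happly] at hpos
    simp only [d, hw, if_true, if_false] at hpos
    nlinarith [mul_self_nonneg (A₀ v w)]
end

section
/- Let α ⊆ {1,…,m} be nonempty, let A₀ be a transversal real skew-symmetric m×m matrix with entries of absolute value ≤ 1, and let A₁, A₂ be transversal real skew-symmetric m×m matrices with entries of absolute value ≤ 1 such that V_{A₁} and V_{A₂} are homotopic and such that the restrictions of both V_{A₁} and V_{A₂} to the face Γ_α are homotopic to the restriction of V_{A₀} to Γ_α (as Volterra operators on S^{|α|−1}). Then there exists a continuous family A(λ), λ ∈ [0,1], of transversal real skew-symmetric m×m matrices with entries of absolute value ≤ 1, with A(0) = A₁ and A(1) = A₂, realizing a homotopy between V_{A₁} and V_{A₂}, such that for every λ ∈ [0,1] the restriction of V_{A(λ)} to Γ_α is homotopic to the restriction of V_{A₀} to Γ_α. In other words, each nonempty intersection of the set F_{V₀}(α) = {V transversal : V|_{Γ_α} ∼ V₀|_{Γ_α}} with a homotopy class is linearly connected. -/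
open Matrix

section VolterraFixedPoints

variable {n : Type*} [Fintype n] [DecidableEq n]

/-- The Volterra matrices that are transversal. -/
def transversalSet (n : Type*) [Fintype n] [DecidableEq n] : Set (Matrix n n ℝ) :=
  {A | IsQSOMatrix A ∧ IsTransversal A}

omit [DecidableEq n] in
lemma mem_FixSet_iff {A : Matrix n n ℝ} {x : n → ℝ} :
    x ∈ FixSet A ↔ x ∈ stdSimplex ℝ n ∧ ∀ k, x k ≠ 0 → (A *ᵥ x) k = 0 := by
  refine and_congr_right fun _ => ?_
  rw [funext_iff]
  refine forall_congr' fun k => ?_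
  change x k * (1 + (A *ᵥ x) k) = x k ↔ _
  constructor
  · intro h hk
    exact (mul_eq_zero.mp (by linarith : x k * (A *ᵥ x) k = 0)).resolve_left hk
  · intro h
    by_cases hk : x k = 0
    · simp [hk]
    · simp [h hk]

omit [DecidableEq n] in
lemma IsQSOMatrix.dotProduct_mulVec_self {A : Matrix n n ℝ} (hA : IsQSOMatrix A) (x : n → ℝ) :
    x ⬝ᵥ (A *ᵥ x) = 0 := by
  have h : x ⬝ᵥ (A *ᵥ x) = -(x ⬝ᵥ (A *ᵥ x)) := by
    conv_lhs => rw [dotProduct_mulVec, ← mulVec_transpose, hA.1, neg_mulVec, neg_dotProduct,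
      dotProduct_comm]
  linarith

omit [DecidableEq n] in
lemma mulVec_eq_sum_of_support_subset (A : Matrix n n ℝ) {s : Finset n} {y : n → ℝ}
    (hy : ∀ k ∉ s, y k = 0) (k : n) : (A *ᵥ y) k = ∑ j : s, A k j * y j := by
  rw [Finset.sum_coe_sort s (fun j => A k j * y j)]
  refine (Finset.sum_subset (Finset.subset_univ s) fun j _ hj => ?_).symm
  simp [hy j hj]

lemma IsTransversal.eq_zero_of_mulVec_eq_zero {A : Matrix n n ℝ} (hA : IsTransversal A)
    {s : Finset n} (hs : Even s.card) {y : n → ℝ} (hy : ∀ k ∉ s, y k = 0)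
    (hk : ∀ k ∈ s, (A *ᵥ y) k = 0) : y = 0 := by
  have h := Matrix.eq_zero_of_mulVec_eq_zero (hA s hs) (v := fun j : s => y j) <| by
    ext k
    exact (mulVec_eq_sum_of_support_subset A hy k).symm.trans (hk k k.2)
  ext k
  by_cases hks : k ∈ s
  · exact congrFun h ⟨k, hks⟩
  · exact hy k hks

/-- For an even set `s` and `i ∉ s`, the generator of the kernel of the principal submatrix
on `insert i s`, normalised to have `i`-th coordinate `1`. -/
noncomputable def faceKernel (s : Finset n) (i : n) (A : Matrix n n ℝ) (j : n) : ℝ :=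
  let B := A.submatrix (fun k : s => (k : n)) (fun k : s => (k : n))
  if h : j ∈ s then -(B.det⁻¹ * (B.adjugate *ᵥ fun k : s => A k i) ⟨j, h⟩)
  else if j = i then 1 else 0

omit [Fintype n] in
lemma faceKernel_self {s : Finset n} {i : n} (hi : i ∉ s) (A : Matrix n n ℝ) :
    faceKernel s i A i = 1 := by
  simp [faceKernel, hi]

omit [Fintype n] in
lemma faceKernel_eq_zero {s : Finset n} {i j : n} (hj : j ∉ insert i s) (A : Matrix n n ℝ) :
    faceKernel s i A j = 0 := by
  rw [Finset.mem_insert, not_or] at hj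
  simp [faceKernel, hj.1, hj.2]

lemma continuous_faceKernel {X : Type*} [TopologicalSpace X] {f : X → Matrix n n ℝ}
    (hf : Continuous f) (ht : ∀ t, IsTransversal (f t)) {s : Finset n} (hs : Even s.card)
    (i j : n) : Continuous fun t => faceKernel s i (f t) j := by
  unfold faceKernel
  by_cases h : j ∈ s
  · simp only [h, dite_true]
    have hB := hf.matrix_submatrix (fun k : s => (k : n)) (fun k : s => (k : n))
    refine ((hB.matrix_det.inv₀ fun t => ht t s hs).mul ?_).neg
    exact (continuous_apply _).comp (hB.matrix_adjugate.matrix_mulVec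
      (continuous_pi fun k => hf.matrix_elem _ _))
  · simp only [h, dite_false]
    exact continuous_const

lemma mulVec_faceKernel {A : Matrix n n ℝ} (hA : A ∈ transversalSet n) {s : Finset n}
    (hs : Even s.card) {i : n} (hi : i ∉ s) {k : n} (hk : k ∈ insert i s) :
    (A *ᵥ faceKernel s i A) k = 0 := by
  have hmem : ∀ k ∈ s, (A *ᵥ faceKernel s i A) k = 0 := by
    intro k hk
    rw [mulVec_eq_sum_of_support_subset A (fun j hj => faceKernel_eq_zero hj A),
      Finset.sum_coe_sort (insert i s) (fun j => A k j * faceKernel s i A j),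
      Finset.sum_insert hi, faceKernel_self hi, mul_one,
      ← Finset.sum_coe_sort s (fun j => A k j * faceKernel s i A j)]
    set B := A.submatrix (fun k : s => (k : n)) (fun k : s => (k : n)) with hB
    set b : s → ℝ := fun k => A k i
    have h : (B *ᵥ (B.adjugate *ᵥ b)) ⟨k, hk⟩ = B.det * A k i := by
      rw [mulVec_mulVec, mul_adjugate, smul_mulVec, one_mulVec]
      rfl
    have hv : ∀ j : s, faceKernel s i A j = -(B.det⁻¹ * (B.adjugate *ᵥ b) j) := fun j => by
      simp [faceKernel, B, b]
    have hsum : ∑ j : s, A k j * faceKernel s i A j =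
        -(B.det⁻¹ * (B *ᵥ (B.adjugate *ᵥ b)) ⟨k, hk⟩) := by
      rw [mulVec_eq_sum, Finset.sum_apply, Finset.mul_sum, ← Finset.sum_neg_distrib]
      refine Finset.sum_congr rfl fun j _ => ?_
      rw [hv]
      simp [hB]
      ring
    rw [hsum, h, inv_mul_cancel_left₀ (hA.2 s hs), add_neg_cancel]
  rcases Finset.mem_insert.mp hk with rfl | hks
  · have h := hA.1.dotProduct_mulVec_self (faceKernel s k A)
    rwa [dotProduct, Finset.sum_eq_single k, faceKernel_self hi, one_mul] at h
    · intro j _ hjk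
      by_cases hj : j ∈ s
      · rw [hmem j hj, mul_zero]
      · rw [faceKernel_eq_zero (by simp [hj, hjk]), zero_mul]
    · simp
  · exact hmem k hks

lemma eq_smul_faceKernel {A : Matrix n n ℝ} (hA : A ∈ transversalSet n) {s : Finset n}
    (hs : Even s.card) {i : n} (hi : i ∉ s) {x : n → ℝ} (hx : ∀ k ∉ insert i s, x k = 0)
    (hk : ∀ k ∈ insert i s, (A *ᵥ x) k = 0) : x = x i • faceKernel s i A := by
  refine sub_eq_zero.mp (hA.2.eq_zero_of_mulVec_eq_zero hs (fun k hks => ?_) fun k hks => ?_)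
  · by_cases hki : k = i
    · simp [hki, faceKernel_self hi]
    · have hkn : k ∉ insert i s := by simp [hki, hks]
      simp [hx k hkn, faceKernel_eq_zero hkn]
  · have hki : k ∈ insert i s := Finset.mem_insert_of_mem hks
    simp [mulVec_sub, mulVec_smul, hk k hki, mulVec_faceKernel hA hs hi hki]

lemma faceKernel_ne_zero {A : Matrix n n ℝ} (hA : A ∈ transversalSet n) {s : Finset n}
    (hs : Even s.card) {i : n} (hi : i ∉ s) {j : n} (hj : j ∈ s) : faceKernel s i A j ≠ 0 := by
  intro h0
  have hji : j ≠ i := fun h => hi (h ▸ hj)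
  have hji' : j ∈ insert i s := Finset.mem_insert_of_mem hj
  have hcard : ((insert i s).erase j).card = s.card := by
    rw [Finset.card_erase_of_mem hji', Finset.card_insert_of_notMem hi, Nat.add_sub_cancel]
  have h := hA.2.eq_zero_of_mulVec_eq_zero (s := (insert i s).erase j) (hcard ▸ hs)
    (y := faceKernel s i A) (fun k hk => ?_)
    fun k hk => mulVec_faceKernel hA hs hi (Finset.mem_of_mem_erase hk)
  · simpa [faceKernel_self hi] using congrFun h i
  · by_cases hkj : k = j
    · rw [hkj, h0]
    · exact faceKernel_eq_zero (fun h => hk (Finset.mem_erase.mpr ⟨hkj, h⟩)) A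

/-- The set of indices of the nonzero coordinates of a vector. -/
noncomputable def coordSupport (x : n → ℝ) : Finset n :=
  {k | x k ≠ 0}

omit [DecidableEq n] in
@[simp]
lemma mem_coordSupport {x : n → ℝ} {k : n} : k ∈ coordSupport x ↔ x k ≠ 0 := by
  simp [coordSupport]

/-- The support of a fixed point has the form `insert i s` with `s` even and `i ∉ s`. -/
lemma exists_coordSupport_eq_insert {A : Matrix n n ℝ} (hA : IsTransversal A) {x : n → ℝ}
    (hx : x ∈ FixSet A) : ∃ i s, i ∉ s ∧ Even s.card ∧ coordSupport x = insert i s := by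
  rw [mem_FixSet_iff] at hx
  have hx0 : x ≠ 0 := by
    rintro rfl
    simpa using hx.1.2
  obtain ⟨i, hi⟩ := Function.ne_iff.mp hx0
  have hi' : i ∈ coordSupport x := mem_coordSupport.mpr hi
  refine ⟨i, (coordSupport x).erase i, Finset.notMem_erase _ _, ?_,
    (Finset.insert_erase hi').symm⟩
  have hodd : ¬ Even (coordSupport x).card := fun he =>
    hx0 (hA.eq_zero_of_mulVec_eq_zero he (by simp) fun k hk => hx.2 k (by simpa using hk))
  rw [Nat.not_even_iff_odd] at hodd
  rw [Finset.card_erase_of_mem hi']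
  exact Nat.Odd.sub_odd hodd odd_one

lemma eq_smul_faceKernel_of_mem_FixSet {A : Matrix n n ℝ} (hA : A ∈ transversalSet n)
    {x : n → ℝ} (hx : x ∈ FixSet A) {s : Finset n} {i : n} (hs : Even s.card) (hi : i ∉ s)
    (hsupp : coordSupport x = insert i s) : x = x i • faceKernel s i A := by
  rw [mem_FixSet_iff] at hx
  refine eq_smul_faceKernel hA hs hi (fun k hk => ?_) fun k hk => hx.2 k ?_
  · rwa [← hsupp, mem_coordSupport, not_not] at hk
  · rwa [← hsupp, mem_coordSupport] at hk

lemma injOn_coordSupport_FixSet {A : Matrix n n ℝ} (hA : A ∈ transversalSet n) :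
    Set.InjOn coordSupport (FixSet A) := by
  intro x hx y hy hxy
  obtain ⟨i, s, hi, hs, hsupp⟩ := exists_coordSupport_eq_insert hA.2 hx
  have h₁ := eq_smul_faceKernel_of_mem_FixSet hA hx hs hi hsupp
  have h₂ := eq_smul_faceKernel_of_mem_FixSet hA hy hs hi (hxy ▸ hsupp)
  have e₁ := hx.1.2
  have e₂ := hy.1.2
  rw [h₁] at e₁
  rw [h₂] at e₂
  simp only [Pi.smul_apply, smul_eq_mul, ← Finset.mul_sum] at e₁ e₂
  rw [h₁, h₂, mul_right_cancel₀ (right_ne_zero_of_mul_eq_one e₁) (e₁.trans e₂.symm)]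

lemma exists_mem_FixSet_of_faceKernel_pos {A : Matrix n n ℝ} (hA : A ∈ transversalSet n)
    {s : Finset n} {i : n} (hs : Even s.card) (hi : i ∉ s)
    (hpos : ∀ j ∈ s, 0 < faceKernel s i A j) :
    ∃ x ∈ FixSet A, coordSupport x = insert i s := by
  have hpos' : ∀ j ∈ insert i s, 0 < faceKernel s i A j := by
    intro j hj
    rcases Finset.mem_insert.mp hj with rfl | hj
    · simp [faceKernel_self hi]
    · exact hpos j hj
  have hnonneg : ∀ j, 0 ≤ faceKernel s i A j := fun j => by
    by_cases hj : j ∈ insert i s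
    · exact (hpos' j hj).le
    · exact (faceKernel_eq_zero hj A).ge
  have hsum : 0 < ∑ j, faceKernel s i A j :=
    Finset.sum_pos' (fun j _ => hnonneg j)
      ⟨i, Finset.mem_univ i, hpos' i (Finset.mem_insert_self i s)⟩
  have hsupp : ∀ j, j ∈ insert i s ↔ faceKernel s i A j ≠ 0 := fun j =>
    ⟨fun hj => (hpos' j hj).ne', fun h => by_contra fun hj => h (faceKernel_eq_zero hj A)⟩
  refine ⟨(∑ j, faceKernel s i A j)⁻¹ • faceKernel s i A, mem_FixSet_iff.mpr ⟨⟨fun j => ?_, ?_⟩,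
    fun k hk => ?_⟩, ?_⟩
  · exact mul_nonneg (inv_nonneg.mpr hsum.le) (hnonneg j)
  · simp only [Pi.smul_apply, smul_eq_mul, ← Finset.mul_sum]
    exact inv_mul_cancel₀ hsum.ne'
  · rw [mulVec_smul, Pi.smul_apply,
      mulVec_faceKernel hA hs hi ((hsupp k).mpr (right_ne_zero_of_mul hk)), smul_zero]
  · ext j
    simp [hsupp, hsum.ne', -Finset.mem_insert]

lemma image_coordSupport_FixSet_subset {X : Type*} [TopologicalSpace X] [PreconnectedSpace X]
    {f : X → Matrix n n ℝ} (hf : Continuous f) (ht : ∀ t, f t ∈ transversalSet n) (t u : X) :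
    coordSupport '' FixSet (f t) ⊆ coordSupport '' FixSet (f u) := by
  rintro _ ⟨x, hx, rfl⟩
  obtain ⟨i, s, hi, hs, hsupp⟩ := exists_coordSupport_eq_insert (ht t).2 hx
  have hker := eq_smul_faceKernel_of_mem_FixSet (ht t) hx hs hi hsupp
  rw [hsupp]
  refine exists_mem_FixSet_of_faceKernel_pos (ht u) hs hi fun j hj => ?_
  have hjt : 0 ≤ faceKernel s i (f t) j := by
    have hxi : 0 < x i := (hx.1.1 i).lt_of_ne' <| by
      rw [← mem_coordSupport, hsupp]
      exact Finset.mem_insert_self i s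
    have hxj : 0 ≤ x i * faceKernel s i (f t) j := by
      simpa using (hx.1.1 j).trans_eq (congrFun hker j)
    exact nonneg_of_mul_nonneg_right hxj hxi
  by_contra! hju
  obtain ⟨v, hv⟩ := mem_range_of_exists_le_of_exists_ge
    (continuous_faceKernel hf (fun t => (ht t).2) hs i j) ⟨u, hju⟩ ⟨t, hjt⟩
  exact faceKernel_ne_zero (ht v) hs hi hj hv

/-- The number of fixed points is constant along a connected family of transversal Volterra
operators. -/
theorem ncard_FixSet_eq {X : Type*} [TopologicalSpace X] [PreconnectedSpace X]
    {f : X → Matrix n n ℝ} (hf : Continuous f) (ht : ∀ t, f t ∈ transversalSet n) (t u : X) :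
    (FixSet (f t)).ncard = (FixSet (f u)).ncard := by
  rw [← (injOn_coordSupport_FixSet (ht t)).ncard_image,
    ← (injOn_coordSupport_FixSet (ht u)).ncard_image,
    (image_coordSupport_FixSet_subset hf ht t u).antisymm
      (image_coordSupport_FixSet_subset hf ht u t)]

/-- Homotopy of Volterra operators is path-connectedness within the transversal ones. -/
theorem qsoHomotopic_iff_joinedIn {A B : Matrix n n ℝ} :
    QSOHomotopic A B ↔ JoinedIn (transversalSet n) A B := by
  constructor
  · rintro ⟨f, hf, h0, h1, hmem, -, -⟩
    exact JoinedIn.ofLine hf h0 h1 (Set.image_subset_iff.mpr hmem)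
  · rintro ⟨γ, hγ⟩
    have hcard : ∀ t : unitInterval, (FixSet (γ t)).ncard = (FixSet A).ncard := fun t => by
      simpa using ncard_FixSet_eq γ.continuous hγ t 0
    refine ⟨γ.extend, γ.continuous_extend.continuousOn, γ.extend_zero, γ.extend_one,
      fun t ht => ?_, fun t ht => ?_, by simpa using (hcard 1).symm⟩
    · rw [γ.extend_apply ht]
      exact hγ _
    · rw [γ.extend_apply ht]
      exact hcard _

end VolterraFixedPoints

lemma IsTransversal.restrictM {m : ℕ} {A : Matrix (Fin m) (Fin m) ℝ} (hA : IsTransversal A)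
    (α : Finset (Fin m)) : IsTransversal (restrictM A α) := by
  intro s hs
  have h := hA (s.map (Function.Embedding.subtype _)) (by rwa [Finset.card_map])
  let e : s ≃ s.map (Function.Embedding.subtype (· ∈ α)) := Finset.equivMap _ s
  rwa [← det_submatrix_equiv_self e] at h

lemma restrictM_mem_transversalSet {m : ℕ} {A : Matrix (Fin m) (Fin m) ℝ}
    (hA : A ∈ transversalSet (Fin m)) (α : Finset (Fin m)) :
    restrictM A α ∈ transversalSet α := by
  refine ⟨⟨?_, fun i j => hA.1.2 i j⟩, hA.2.restrictM α⟩
  ext i j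
  exact congrFun (congrFun hA.1.1 i) j

theorem face_class_intersection_linearly_connected {m : ℕ}
    (α : Finset (Fin m)) (hα : α.Nonempty)
    (A₀ A₁ A₂ : Matrix (Fin m) (Fin m) ℝ)
    (h₀ : IsQSOMatrix A₀) (t₀ : IsTransversal A₀)
    (h₁ : IsQSOMatrix A₁) (t₁ : IsTransversal A₁)
    (h₂ : IsQSOMatrix A₂) (t₂ : IsTransversal A₂)
    (h12 : QSOHomotopic A₁ A₂)
    (hr1 : QSOHomotopic (restrictM A₁ α) (restrictM A₀ α))
    (hr2 : QSOHomotopic (restrictM A₂ α) (restrictM A₀ α)) :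
    ∃ A : ℝ → Matrix (Fin m) (Fin m) ℝ,
      ContinuousOn A (Set.Icc 0 1) ∧
      A 0 = A₁ ∧ A 1 = A₂ ∧
      (∀ t ∈ Set.Icc (0:ℝ) 1, IsQSOMatrix (A t) ∧ IsTransversal (A t)) ∧
      (∀ t ∈ Set.Icc (0:ℝ) 1, (FixSet (A t)).ncard = (FixSet A₁).ncard) ∧
      (FixSet A₁).ncard = (FixSet A₂).ncard ∧
      (∀ t ∈ Set.Icc (0:ℝ) 1,
        QSOHomotopic (restrictM (A t) α) (restrictM A₀ α)) := by
  obtain ⟨A, hA, h0, h1, hmem, hcard, hcard'⟩ := h12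
  refine ⟨A, hA, h0, h1, hmem, hcard, hcard', fun t ht => ?_⟩
  rw [qsoHomotopic_iff_joinedIn] at hr1 ⊢
  refine JoinedIn.trans (JoinedIn.symm ?_) hr1
  have hmaps : Set.MapsTo (fun u : ℝ => t * u) (Set.Icc 0 1) (Set.Icc 0 1) := fun u hu =>
    ⟨mul_nonneg ht.1 hu.1, mul_le_one₀ ht.2 hu.1 hu.2⟩
  have hcont : ContinuousOn (fun u => restrictM (A (t * u)) α) (Set.Icc 0 1) :=
    (continuous_id.matrix_submatrix _ _).comp_continuousOn
      (hA.comp (continuous_const_mul t).continuousOn hmaps)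
  refine JoinedIn.ofLine hcont (by simp [h0]) (by simp) ?_
  rintro _ ⟨u, hu, rfl⟩
  exact restrictM_mem_transversalSet (hmem _ (hmaps hu)) α
end

section
/- Let m be odd and let A be a real skew-symmetric m×m matrix. Then there exists a vector v ∈ ℝ^m such that the adjugate (classical adjoint) of A equals the rank-one matrix v vᵀ, i.e. (adj A)_{ik} = v_i v_k for all i, k. -/
open Matrix

namespace Matrix

variable {n : Type*} [Fintype n]

/-- The quadratic form of a real skew-symmetric matrix vanishes. -/
lemma mulVec_dotProduct_self_of_transpose_eq_neg {A : Matrix n n ℝ} (hA : Aᵀ = -A) (x : n → ℝ) :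
    (A *ᵥ x) ⬝ᵥ x = 0 := by
  have h : (A *ᵥ x) ⬝ᵥ x = -((A *ᵥ x) ⬝ᵥ x) := by
    conv_lhs => rw [dotProduct_comm, dotProduct_mulVec, ← mulVec_transpose, hA, neg_mulVec,
      neg_dotProduct]
  linarith

variable [DecidableEq n]

lemma add_smul_one_mulVec_dotProduct_self {A : Matrix n n ℝ} (hA : Aᵀ = -A) (t : ℝ) (x : n → ℝ) :
    ((A + t • (1 : Matrix n n ℝ)) *ᵥ x) ⬝ᵥ x = t * (x ⬝ᵥ x) := by
  rw [add_mulVec, add_dotProduct, mulVec_dotProduct_self_of_transpose_eq_neg hA, smul_mulVec,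
    one_mulVec, smul_dotProduct, zero_add, smul_eq_mul]

lemma det_add_smul_one_ne_zero {A : Matrix n n ℝ} (hA : Aᵀ = -A) {t : ℝ} (ht : t ≠ 0) :
    (A + t • (1 : Matrix n n ℝ)).det ≠ 0 := by
  intro h
  obtain ⟨x, hx, hMx⟩ := exists_mulVec_eq_zero_iff.mpr h
  have hq := add_smul_one_mulVec_dotProduct_self hA t x
  rw [hMx, zero_dotProduct] at hq
  have hxx : x ⬝ᵥ x = 0 := (mul_eq_zero.mp hq.symm).resolve_left ht
  exact hx (dotProduct_self_eq_zero.mp hxx)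

lemma det_add_smul_one_pos {A : Matrix n n ℝ} (hA : Aᵀ = -A) {t : ℝ} (ht : 0 < t) :
    0 < (A + t • (1 : Matrix n n ℝ)).det := by
  by_contra! hneg
  have hcont : ContinuousOn (fun s : ℝ => (s • A + t • (1 : Matrix n n ℝ)).det) (Set.Icc 0 1) := by
    fun_prop
  have hmem : (0 : ℝ) ∈ Set.Icc ((1 : ℝ) • A + t • (1 : Matrix n n ℝ)).det
      ((0 : ℝ) • A + t • (1 : Matrix n n ℝ)).det := by
    constructor
    · simpa using hneg
    · simp [ht.le]
  obtain ⟨s, -, hs⟩ := intermediate_value_Icc' zero_le_one hcont hmem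
  exact det_add_smul_one_ne_zero (A := s • A) (by rw [transpose_smul, hA, smul_neg]) ht.ne' hs

lemma dotProduct_adjugate_add_smul_one_mulVec_nonneg {A : Matrix n n ℝ} (hA : Aᵀ = -A)
    {t : ℝ} (ht : 0 < t) (x : n → ℝ) :
    0 ≤ x ⬝ᵥ ((A + t • (1 : Matrix n n ℝ)).adjugate *ᵥ x) := by
  set M := A + t • (1 : Matrix n n ℝ) with hM
  have hq := add_smul_one_mulVec_dotProduct_self hA t (M.adjugate *ᵥ x)
  rw [← hM, mulVec_mulVec, mul_adjugate, smul_mulVec, one_mulVec, smul_dotProduct,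
    smul_eq_mul] at hq
  refine nonneg_of_mul_nonneg_right (a := M.det) ?_ (det_add_smul_one_pos hA ht)
  rw [hq]
  exact mul_nonneg ht.le (Finset.sum_nonneg fun i _ => mul_self_nonneg _)

/-- The quadratic form of the adjugate of a real skew-symmetric matrix is nonnegative. -/
lemma dotProduct_adjugate_mulVec_nonneg {A : Matrix n n ℝ} (hA : Aᵀ = -A) (x : n → ℝ) :
    0 ≤ x ⬝ᵥ (A.adjugate *ᵥ x) := by
  have hcont : Continuous fun t : ℝ => x ⬝ᵥ ((A + t • (1 : Matrix n n ℝ)).adjugate *ᵥ x) := by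
    fun_prop
  have hlim := (hcont.tendsto 0).mono_left (nhdsWithin_le_nhds (s := Set.Ioi 0))
  simp only [zero_smul, add_zero] at hlim
  exact ge_of_tendsto hlim (eventually_mem_nhdsWithin.mono fun t ht =>
    dotProduct_adjugate_add_smul_one_mulVec_nonneg hA ht x)

lemma det_eq_zero_of_transpose_eq_neg {A : Matrix n n ℝ} (hn : Odd (Fintype.card n))
    (hA : Aᵀ = -A) : A.det = 0 := by
  have h : A.det = -A.det := by
    conv_lhs => rw [← det_transpose, hA, det_neg, hn.neg_one_pow, neg_one_mul]
  linarith

lemma adjugate_isSymm_of_transpose_eq_neg {A : Matrix n n ℝ} (hn : Odd (Fintype.card n))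
    (hA : Aᵀ = -A) : A.adjugate.IsSymm := by
  rw [IsSymm, adjugate_transpose, hA, ← neg_one_smul ℝ A, adjugate_smul,
    (Nat.Odd.sub_odd hn odd_one).neg_one_pow, one_smul]

/-- A kernel vector vanishing at `i` is zero if the `i`-th principal minor is nonzero. -/
lemma eq_zero_of_mulVec_eq_zero_of_adjugate_ne_zero {K : Type*} [Field K] {A : Matrix n n K}
    {i : n} (hi : A.adjugate i i ≠ 0) {x : n → K} (hx : A *ᵥ x = 0) (hxi : x i = 0) : x = 0 := by
  rw [adjugate_apply] at hi
  refine eq_zero_of_mulVec_eq_zero hi (funext fun j => ?_)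
  by_cases hj : j = i
  · subst hj
    simp [mulVec, hxi]
  · simpa [mulVec, updateRow_ne hj] using congrFun hx j

lemma adjugate_mul_adjugate_of_det_eq_zero {K : Type*} [Field K] {A : Matrix n n K}
    (hdet : A.det = 0) {i : n} (hi : A.adjugate i i ≠ 0) (j k : n) :
    A.adjugate i i * A.adjugate j k = A.adjugate i k * A.adjugate j i := by
  have hker (l : n) : A *ᵥ A.adjugate.col l = 0 := by
    rw [← mulVec_single_one, mulVec_mulVec, mul_adjugate, hdet, zero_smul, zero_mulVec]
  have h := eq_zero_of_mulVec_eq_zero_of_adjugate_ne_zero hi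
    (x := A.adjugate i i • A.adjugate.col k - A.adjugate i k • A.adjugate.col i)
    (by rw [mulVec_sub, mulVec_smul, mulVec_smul, hker, hker, smul_zero, smul_zero, sub_zero])
    (by simp [mul_comm])
  simpa [sub_eq_zero] using congrFun h j

end Matrix

theorem adjugate_skew_odd_rank_one {m : ℕ} (hm : Odd m)
    (A : Matrix (Fin m) (Fin m) ℝ) (hA : Aᵀ = -A) :
    ∃ v : Fin m → ℝ, ∀ i k, A.adjugate i k = v i * v k := by
  have hcard : Odd (Fintype.card (Fin m)) := by rwa [Fintype.card_fin]
  have hsymm := adjugate_isSymm_of_transpose_eq_neg hcard hA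
  by_cases hdiag : ∃ i, A.adjugate i i ≠ 0
  · obtain ⟨i, hi⟩ := hdiag
    have hnonneg : 0 ≤ A.adjugate i i := by
      simpa using dotProduct_adjugate_mulVec_nonneg hA (Pi.single i 1)
    refine ⟨fun k => A.adjugate i k / √(A.adjugate i i), fun j k => ?_⟩
    have h := adjugate_mul_adjugate_of_det_eq_zero (det_eq_zero_of_transpose_eq_neg hcard hA) hi j k
    rw [div_mul_div_comm, Real.mul_self_sqrt hnonneg, eq_div_iff hi, mul_comm, h,
      hsymm.apply i j, mul_comm]
  · push Not at hdiag
    refine ⟨0, fun j k => ?_⟩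
    have hadd := dotProduct_adjugate_mulVec_nonneg hA (Pi.single j 1 + Pi.single k 1)
    have hsub := dotProduct_adjugate_mulVec_nonneg hA (Pi.single j 1 - Pi.single k 1)
    simp only [mulVec_add, mulVec_sub, add_dotProduct, sub_dotProduct, dotProduct_add,
      dotProduct_sub, mulVec_single_one, single_one_dotProduct, col_apply, hdiag,
      hsymm.apply j k] at hadd hsub
    simp only [Pi.zero_apply, mul_zero]
    linarith
end

section
/- Let m be odd and let A be a transversal real skew-symmetric m×m matrix. Then there exists a nonzero vector x ∈ ℝ^m with A x = 0 such that for every k ∈ {1,…,m}, the square of the k-th coordinate of x equals the determinant of the principal submatrix of A obtained by deleting the k-th row and k-th column: x_k² = det(A_{k̂}). In particular every coordinate of x is nonzero. -/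
open Matrix

/-- The submatrix of `A` obtained by deleting the `k`-th row and column. -/
abbrev Matrix.deleteIndex {n R : Type*} (A : Matrix n n R) (k : n) :
    Matrix {i // i ≠ k} {i // i ≠ k} R :=
  A.submatrix (fun i => (i : n)) (fun i => (i : n))

/-- The quadratic form of a real skew-symmetric matrix vanishes. -/
lemma dotProduct_mulVec_self_of_skew {n : Type*} [Fintype n] {A : Matrix n n ℝ}
    (hA : Aᵀ = -A) (v : n → ℝ) : v ⬝ᵥ A *ᵥ v = 0 := by
  have h : v ⬝ᵥ A *ᵥ v = -(v ⬝ᵥ A *ᵥ v) := by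
    conv_lhs => rw [dotProduct_mulVec, ← mulVec_transpose, hA, neg_mulVec, neg_dotProduct,
      dotProduct_comm]
  linarith

/-- A nonsingular real skew-symmetric matrix has positive determinant. -/
lemma det_pos_of_skew {n : Type*} [Fintype n] [DecidableEq n] {A : Matrix n n ℝ}
    (hA : Aᵀ = -A) (hdet : A.det ≠ 0) : 0 < A.det := by
  let f : ℝ → ℝ := fun t => ((1 - t) • (1 : Matrix n n ℝ) + t • A).det
  have hf : Continuous f := by fun_prop
  have hne : ∀ t ∈ Set.Icc (0 : ℝ) 1, f t ≠ 0 := by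
    intro t ht h0
    rcases eq_or_lt_of_le ht.2 with rfl | hlt
    · exact hdet (by simpa [f] using h0)
    · obtain ⟨v, hv, hv0⟩ := exists_mulVec_eq_zero_iff.mpr h0
      have h := congrArg (v ⬝ᵥ ·) hv0
      simp only [add_mulVec, smul_mulVec, one_mulVec, dotProduct_add, dotProduct_smul,
        dotProduct_mulVec_self_of_skew hA, dotProduct_zero, smul_eq_mul, mul_zero, add_zero] at h
      rcases mul_eq_zero.mp h with h | h
      · linarith
      · exact hv (dotProduct_self_eq_zero.mp h)
  by_contra hneg
  have h0 : f 0 = 1 := by simp [f]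
  have h1 : f 1 = A.det := by simp [f]
  obtain ⟨t, ht, h⟩ := intermediate_value_Icc' (zero_le_one' ℝ) hf.continuousOn
    (show (0 : ℝ) ∈ Set.Icc (f 1) (f 0) from ⟨by linarith, by linarith⟩)
  exact hne t ht h

/-- A skew-symmetric real matrix of odd order is singular. -/
lemma det_eq_zero_of_skew_of_odd {n : Type*} [Fintype n] [DecidableEq n] {A : Matrix n n ℝ}
    (hA : Aᵀ = -A) (hn : Odd (Fintype.card n)) : A.det = 0 := by
  have h := congrArg det hA
  rw [det_transpose, det_neg, hn.neg_one_pow] at h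
  linarith

/-- The adjugate of a skew-symmetric matrix of odd order is symmetric. -/
lemma adjugate_isSymm_of_skew_of_odd {n : Type*} [Fintype n] [DecidableEq n]
    {A : Matrix n n ℝ} (hA : Aᵀ = -A) (hn : Odd (Fintype.card n)) : A.adjugate.IsSymm := by
  have hev : Even (Fintype.card n - 1) := hn.tsub_odd odd_one
  rw [IsSymm, adjugate_transpose, hA, ← neg_one_smul ℝ A, adjugate_smul, hev.neg_one_pow,
    one_smul]

/-- The diagonal entries of the adjugate are the principal minors of corank one. -/
lemma adjugate_diag_eq_det_deleteIndex {m : ℕ} {R : Type*} [CommRing R]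
    (A : Matrix (Fin m) (Fin m) R) (k : Fin m) :
    A.adjugate k k = (A.deleteIndex k).det := by
  cases m with
  | zero => exact k.elim0
  | succ n =>
    rw [adjugate_fin_succ_eq_det_submatrix, Even.neg_one_pow ⟨_, rfl⟩, one_mul,
      ← det_submatrix_equiv_self (finSuccAboveEquiv k)]
    rfl

/-- If deleting the index `k` leaves a nonsingular matrix, a kernel vector is determined by its
`k`-th coordinate. -/
lemma eq_zero_of_mulVec_eq_zero_of_apply_eq_zero {n : Type*} [Fintype n] [DecidableEq n]
    {A : Matrix n n ℝ} {k : n} (hk : (A.deleteIndex k).det ≠ 0) {v : n → ℝ}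
    (hv : A *ᵥ v = 0) (hvk : v k = 0) : v = 0 := by
  have h : A.deleteIndex k *ᵥ (fun i => v i) = 0 := by
    funext i
    have hi := congrFun hv i
    rw [mulVec, dotProduct, ← Fintype.sum_subtype_add_sum_subtype (· ≠ k)] at hi
    have hz : ∑ j : {j // ¬ j ≠ k}, A i j * v j = 0 :=
      Finset.sum_eq_zero fun j _ => by rw [not_not.mp j.2, hvk, mul_zero]
    rwa [hz, add_zero] at hi
  have h' := eq_zero_of_mulVec_eq_zero hk h
  funext i
  by_cases hik : i = k
  · rw [hik, hvk]; rfl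
  · exact congrFun h' ⟨i, hik⟩

/-- The corank one principal minors of a transversal matrix of odd order do not vanish. -/
lemma IsTransversal.det_deleteIndex_ne_zero {n : Type*} [Fintype n] [DecidableEq n]
    {A : Matrix n n ℝ} (hT : IsTransversal A) (hn : Odd (Fintype.card n)) (k : n) :
    (A.deleteIndex k).det ≠ 0 := by
  have h := hT (Finset.univ.erase k) (by
    rw [Finset.card_erase_of_mem (Finset.mem_univ k), Finset.card_univ]
    exact hn.tsub_odd odd_one)
  let e : {i // i ≠ k} ≃ (Finset.univ.erase k : Finset n) :=
    Equiv.subtypeEquivRight (by simp)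
  rwa [← det_submatrix_equiv_self e] at h

theorem kernel_vector_squares_eq_principal_minors {m : ℕ} (hm : Odd m)
    (A : Matrix (Fin m) (Fin m) ℝ) (hA : Aᵀ = -A) (hT : IsTransversal A) :
    ∃ x : Fin m → ℝ, x ≠ 0 ∧ A.mulVec x = 0 ∧
      (∀ k : Fin m, (x k) ^ 2 =
        (A.submatrix (fun i : {i : Fin m // i ≠ k} => (i : Fin m))
          (fun i : {i : Fin m // i ≠ k} => (i : Fin m))).det) ∧
      (∀ k, x k ≠ 0) := by
  have hcard : Odd (Fintype.card (Fin m)) := by simpa using hm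
  have hne := hT.det_deleteIndex_ne_zero hcard
  let B := A.adjugate
  have hB : ∀ k, B k k = (A.deleteIndex k).det := adjugate_diag_eq_det_deleteIndex A
  have hsymm : ∀ i j, B j i = B i j := (adjugate_isSymm_of_skew_of_odd hA hcard).apply
  have hker : ∀ k, A *ᵥ B.col k = 0 := by
    intro k
    have h : A * B = 0 := by rw [mul_adjugate, det_eq_zero_of_skew_of_odd hA hcard, zero_smul]
    funext i
    exact congrFun (congrFun h i) k
  let o : Fin m := ⟨0, hm.pos⟩
  have hpos : 0 < B o o := by
    rw [hB]
    refine det_pos_of_skew ?_ (hne o)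
    rw [transpose_submatrix, hA]
    rfl
  have hminor : ∀ k, B k o ^ 2 = B o o * B k k := by
    intro k
    have h := eq_zero_of_mulVec_eq_zero_of_apply_eq_zero (hne o)
      (v := B o o • B.col k - B o k • B.col o)
      (by rw [mulVec_sub, mulVec_smul, mulVec_smul, hker, hker]; simp)
      (by simp [mul_comm])
    have hk := congrFun h k
    simp only [Pi.sub_apply, Pi.smul_apply, col_apply, smul_eq_mul, Pi.zero_apply,
      hsymm k o] at hk
    linarith
  let x : Fin m → ℝ := (√(B o o))⁻¹ • B.col o
  have hsq : ∀ k, x k ^ 2 = (A.deleteIndex k).det := by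
    intro k
    rw [← hB]
    simp only [x, Pi.smul_apply, col_apply, smul_eq_mul, mul_pow, inv_pow,
      Real.sq_sqrt hpos.le, hminor]
    field_simp
  have hx : ∀ k, x k ≠ 0 := fun k h => hne k (by rw [← hsq, h]; simp)
  exact ⟨x, fun h => hx o (congrFun h o), by rw [mulVec_smul, hker, smul_zero], hsq, hx⟩
end

section
/- Let A be a transversal real skew-symmetric m×m matrix with entries of absolute value ≤ 1 and let V_A be its Volterra operator on S^{m−1}. Then: (i) the fixed point set Fix(V_A) is finite; (ii) for every fixed point x ∈ Fix(V_A), the support supp(x) = {k : x_k ≠ 0} has odd cardinality; and (iii) for every subset α ⊆ {1,…,m}, the relative interior riΓ_α = {x ∈ S^{m−1} : x_i > 0 for all i ∈ α, x_i = 0 for all i ∉ α} contains at most one fixed point of V_A. -/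
open Matrix

/-- The face `Γ_α` of the simplex. -/
def face {m : ℕ} (α : Finset (Fin m)) : Set (Fin m → ℝ) :=
  {x ∈ stdSimplex ℝ (Fin m) | ∀ i ∉ α, x i = 0}

/-- The relative interior `ri Γ_α` of the face `Γ_α`. -/
def riFace {m : ℕ} (α : Finset (Fin m)) : Set (Fin m → ℝ) :=
  {x ∈ stdSimplex ℝ (Fin m) | (∀ i ∈ α, 0 < x i) ∧ ∀ i ∉ α, x i = 0}

/-- For a transversal matrix, a vector supported on an evenly-sized index set on which its image
vanishes is zero. -/
lemma IsTransversal.eq_zero_of_even {n : Type*} [Fintype n] [DecidableEq n]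
    {A : Matrix n n ℝ} (hT : IsTransversal A) {s : Finset n} (hs : Even s.card) {y : n → ℝ}
    (hy : ∀ i ∉ s, y i = 0) (hAy : ∀ k ∈ s, ∑ i, A k i * y i = 0) : y = 0 := by
  have hres : (fun i : s => y i) = 0 := by
    refine Matrix.eq_zero_of_mulVec_eq_zero (hT s hs) (funext fun k => ?_)
    rw [Pi.zero_apply, ← hAy k k.2]
    simp only [Matrix.mulVec, dotProduct, Matrix.submatrix_apply]
    rw [Finset.sum_coe_sort s (fun i => A k i * y i)]
    exact Finset.sum_subset (Finset.subset_univ s) fun i _ hi => by rw [hy i hi, mul_zero]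
  funext i
  by_cases hi : i ∈ s
  · exact congrFun hres ⟨i, hi⟩
  · exact hy i hi

lemma sum_mul_eq_zero_of_mem_FixSet {n : Type*} [Fintype n] {A : Matrix n n ℝ} {x : n → ℝ}
    (hx : x ∈ FixSet A) {k : n} (hk : x k ≠ 0) : ∑ i, A k i * x i = 0 := by
  have h : x k * (1 + ∑ i, A k i * x i) = x k := congrFun hx.2 k
  have h' : x k * ∑ i, A k i * x i = 0 := by linear_combination h
  exact (mul_eq_zero.mp h').resolve_left hk

lemma ne_zero_of_mem_stdSimplex {n : Type*} [Fintype n] {x : n → ℝ}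
    (hx : x ∈ stdSimplex ℝ n) : x ≠ 0 := by
  rintro rfl
  simpa using hx.2

lemma IsTransversal.odd_card_support {n : Type*} [Fintype n] [DecidableEq n]
    {A : Matrix n n ℝ} (hT : IsTransversal A) {x : n → ℝ} (hx : x ∈ FixSet A) {s : Finset n}
    (hs : ∀ k, k ∈ s ↔ x k ≠ 0) : Odd s.card := by
  by_contra hodd
  refine ne_zero_of_mem_stdSimplex hx.1
    (hT.eq_zero_of_even (Nat.not_odd_iff_even.mp hodd) (fun i hi => ?_) fun k hk =>
      sum_mul_eq_zero_of_mem_FixSet hx ((hs k).mp hk))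
  by_contra h
  exact hi ((hs i).mpr h)

lemma mem_iff_ne_zero_of_mem_riFace {m : ℕ} {α : Finset (Fin m)} {x : Fin m → ℝ}
    (hx : x ∈ riFace α) (k : Fin m) : k ∈ α ↔ x k ≠ 0 :=
  ⟨fun hk => (hx.2.1 k hk).ne', fun hk => by_contra fun h => hk (hx.2.2 k h)⟩

lemma IsTransversal.subsingleton_FixSet_inter_riFace {m : ℕ} {A : Matrix (Fin m) (Fin m) ℝ}
    (hT : IsTransversal A) (α : Finset (Fin m)) : (FixSet A ∩ riFace α).Subsingleton := by
  rintro x ⟨hx, hxα⟩ y ⟨hy, hyα⟩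
  have hodd := hT.odd_card_support hx (mem_iff_ne_zero_of_mem_riFace hxα)
  obtain ⟨k, hk⟩ := Finset.card_pos.mp hodd.pos
  have hyk : y k ≠ 0 := (hyα.2.1 k hk).ne'
  have hz : x - (x k / y k) • y = 0 := by
    refine hT.eq_zero_of_even (s := α.erase k) ?_ (fun i hi => ?_) fun j hj => ?_
    · rw [Finset.card_erase_of_mem hk]
      exact hodd.tsub_odd odd_one
    · simp only [Pi.sub_apply, Pi.smul_apply, smul_eq_mul]
      rcases eq_or_ne i k with rfl | hik
      · rw [div_mul_cancel₀ _ hyk, sub_self]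
      · have hiα : i ∉ α := fun h => hi (Finset.mem_erase.mpr ⟨hik, h⟩)
        rw [hxα.2.2 i hiα, hyα.2.2 i hiα, mul_zero, sub_zero]
    · have hjα := Finset.mem_of_mem_erase hj
      have hAx := sum_mul_eq_zero_of_mem_FixSet hx (hxα.2.1 j hjα).ne'
      have hAy := sum_mul_eq_zero_of_mem_FixSet hy (hyα.2.1 j hjα).ne'
      simp only [Pi.sub_apply, Pi.smul_apply, smul_eq_mul, mul_sub, Finset.sum_sub_distrib,
        mul_left_comm _ (x k / y k), ← Finset.mul_sum, hAx, hAy, mul_zero, sub_zero]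
  have hxy : x = (x k / y k) • y := sub_eq_zero.mp hz
  have hc : x k / y k = 1 := by
    have h : ∑ i, x i = ∑ i, (x k / y k) * y i :=
      Finset.sum_congr rfl fun i _ => congrFun hxy i
    rw [← Finset.mul_sum, hx.1.2, hy.1.2, mul_one] at h
    exact h.symm
  rwa [hc, one_smul] at hxy

lemma exists_mem_riFace {m : ℕ} {x : Fin m → ℝ} (hx : x ∈ stdSimplex ℝ (Fin m)) :
    ∃ α : Finset (Fin m), x ∈ riFace α :=
  ⟨Finset.univ.filter fun k => x k ≠ 0, hx,
    fun i hi => (hx.1 i).lt_of_ne' (Finset.mem_filter.mp hi).2, fun i hi => by simpa using hi⟩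

theorem transversal_fixed_points_properties {m : ℕ}
    (A : Matrix (Fin m) (Fin m) ℝ) (hA : IsQSOMatrix A) (hT : IsTransversal A) :
    (FixSet A).Finite ∧
    (∀ x ∈ FixSet A, Odd (Set.ncard {k : Fin m | x k ≠ 0})) ∧
    (∀ α : Finset (Fin m), (FixSet A ∩ riFace α).Subsingleton) := by
  refine ⟨?_, fun x hx => ?_, hT.subsingleton_FixSet_inter_riFace⟩
  · refine (Set.finite_iUnion fun α => (hT.subsingleton_FixSet_inter_riFace α).finite).subset
      fun x hx => ?_
    obtain ⟨α, hα⟩ := exists_mem_riFace hx.1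
    exact Set.mem_iUnion.mpr ⟨α, hx, hα⟩
  · obtain ⟨α, hα⟩ := exists_mem_riFace hx.1
    have hmem := mem_iff_ne_zero_of_mem_riFace hα
    have hset : {k : Fin m | x k ≠ 0} = α := Set.ext fun k => (hmem k).symm
    rw [hset, Set.ncard_coe_finset]
    exact hT.odd_card_support hx hmem
end
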